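/- arXiv:2406.03654 — 2 statements merged into one kernel-verified Lean document; each statement's English description precedes it below -/
import Mathlib

section
/- Let $n$ be a natural number and $p_1, \dots, p_n$ real numbers with $0 \le p_s \le 1$ for all $s$. Then $0 \le \sum_{s=1}^{n} p_s - \left(1 - \prod_{s=1}^{n}(1 - p_s)\right) \le \frac{1}{2}\left(\sum_{s=1}^{n} p_s\right)^2$. -/
/-- The Weierstrass product inequality. -/
theorem one_sub_sum_le_prod_one_sub_real {ι : Type*} (s : Finset ι) (p : ι → ℝ)
    (hp0 : ∀ i ∈ s, 0 ≤ p i) (hp1 : ∀ i ∈ s, p i ≤ 1) :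
    1 - ∑ i ∈ s, p i ≤ ∏ i ∈ s, (1 - p i) := by
  induction s using Finset.cons_induction with
  | empty => simp
  | cons a s ha ih =>
    simp only [Finset.forall_mem_cons] at hp0 hp1
    rw [Finset.sum_cons, Finset.prod_cons]
    have hprod : ∏ i ∈ s, (1 - p i) ≤ 1 :=
      Finset.prod_le_one (fun i hi => sub_nonneg.2 (hp1.2 i hi))
        fun i hi => sub_le_self _ (hp0.2 i hi)
    linarith [ih hp0.2 hp1.2, mul_le_mul_of_nonneg_left hprod hp0.1]

/-- The second-order upper bound complementing the Weierstrass product inequality. -/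
theorem prod_one_sub_le_one_sub_sum_add_sq {ι : Type*} (s : Finset ι) (p : ι → ℝ)
    (hp0 : ∀ i ∈ s, 0 ≤ p i) (hp1 : ∀ i ∈ s, p i ≤ 1) :
    ∏ i ∈ s, (1 - p i) ≤ 1 - ∑ i ∈ s, p i + (1 / 2) * (∑ i ∈ s, p i) ^ 2 := by
  induction s using Finset.cons_induction with
  | empty => simp
  | cons a s ha ih =>
    simp only [Finset.forall_mem_cons] at hp0 hp1
    rw [Finset.sum_cons, Finset.prod_cons]
    have hprod := one_sub_sum_le_prod_one_sub_real s p hp0.2 hp1.2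
    linarith [ih hp0.2 hp1.2, mul_le_mul_of_nonneg_left hprod hp0.1, sq_nonneg (p a)]

/-- Error bound for the small-probability approximation of the total
probability of collision. -/
theorem sum_sub_tpoc_bounds (n : ℕ) (p : Fin n → ℝ)
    (hp0 : ∀ s, 0 ≤ p s) (hp1 : ∀ s, p s ≤ 1) :
    0 ≤ (∑ s : Fin n, p s) - (1 - ∏ s : Fin n, (1 - p s)) ∧
      (∑ s : Fin n, p s) - (1 - ∏ s : Fin n, (1 - p s)) ≤
        (1 / 2) * (∑ s : Fin n, p s) ^ 2 := by
  have hlower := one_sub_sum_le_prod_one_sub_real Finset.univ p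
    (fun s _ => hp0 s) (fun s _ => hp1 s)
  have hupper := prod_one_sub_le_one_sub_sum_add_sq Finset.univ p
    (fun s _ => hp0 s) (fun s _ => hp1 s)
  constructor <;> linarith
end

section
/- Let $P$ be a symmetric positive definite $n \times n$ real matrix and $\bar{d} > 0$. Let $z \in \mathbb{R}^n$ lie on the boundary of the keep-out ellipsoid, i.e., $z^\top P^{-1} z = \bar{d}^2$. Then every $r \in \mathbb{R}^n$ satisfying the linearized constraint $(P^{-1} z)^\top (r - z) \ge 0$ satisfies the original constraint $r^\top P^{-1} r \ge \bar{d}^2$. -/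
open Matrix

/-- The quadratic form of a positive semidefinite matrix lies above its tangent at any point. -/
theorem Matrix.PosSemidef.tangent_le_dotProduct_mulVec {ι : Type*} [Fintype ι]
    {Q : Matrix ι ι ℝ} (hQ : Q.PosSemidef) (z r : ι → ℝ) :
    z ⬝ᵥ Q *ᵥ z + 2 * ((Q *ᵥ z) ⬝ᵥ (r - z)) ≤ r ⬝ᵥ Q *ᵥ r := by
  have hnonneg : 0 ≤ (r - z) ⬝ᵥ Q *ᵥ (r - z) := by
    simpa using hQ.dotProduct_mulVec_nonneg (r - z)
  have hsymm : z ⬝ᵥ Q *ᵥ r = r ⬝ᵥ Q *ᵥ z := by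
    have hQt : Qᵀ = Q := by simpa using hQ.isHermitian.eq
    rw [dotProduct_mulVec, ← mulVec_transpose, hQt, dotProduct_comm]
  rw [dotProduct_comm (Q *ᵥ z)]
  simp only [mulVec_sub, dotProduct_sub, sub_dotProduct] at hnonneg ⊢
  linarith

/-- The half-space (linearized keep-out-zone) constraint at a boundary point
`z` of the ellipsoid `{r : rᵀ P⁻¹ r = d̄²}` is a conservative approximation:
any `r` in the half-space `{r : (P⁻¹ z)ᵀ (r - z) ≥ 0}` satisfies the original
squared-Mahalanobis-distance constraint `rᵀ P⁻¹ r ≥ d̄²`. -/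
theorem linearized_smd_constraint_conservative
    {n : ℕ} (P : Matrix (Fin n) (Fin n) ℝ) (hP : P.PosDef) (hPsymm : P.IsSymm)
    (dbar : ℝ) (hdbar : 0 < dbar)
    (z : Fin n → ℝ) (hz : z ⬝ᵥ P⁻¹ *ᵥ z = dbar ^ 2)
    (r : Fin n → ℝ) (hr : 0 ≤ (P⁻¹ *ᵥ z) ⬝ᵥ (r - z)) :
    dbar ^ 2 ≤ r ⬝ᵥ P⁻¹ *ᵥ r := by
  linarith [hP.inv.posSemidef.tangent_le_dotProduct_mulVec z r]
end
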